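/- arXiv:2001.08628 — 2 statements merged into one kernel-verified Lean document; each statement's English description precedes it below -/
import Mathlib

section
/- For every real ε > 0 there is an integer n₀ such that for every integer n ≥ n₀, the poset ({1, …, n}, ∣) of integers from 1 to n ordered by divisibility satisfies ldim({1, …, n}, ∣) ≥ (1/4 − ε) · log n / log log n. -/
open scoped Classical

namespace PaperLD

/-- A partial linear extension of a poset `α`: a duplicate-free list whose
listing order extends the partial order on the elements it contains. -/
structure PLE (α : Type*) [PartialOrder α] where
  toList : List α
  nodup : toList.Nodup
  le_imp : ∀ i j : Fin toList.length, toList.get i ≤ toList.get j → i ≤ j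

/-- `x` occurs (weakly) before `y` in the partial linear extension `L`
(in particular both `x` and `y` belong to the ground set of `L`). -/
def PLE.Before {α : Type*} [PartialOrder α] (L : PLE α) (x y : α) : Prop :=
  ∃ i j : Fin L.toList.length, i ≤ j ∧ L.toList.get i = x ∧ L.toList.get j = y

/-- A family of partial linear extensions is a local realiser if, for every
ordered pair `(x, y)` with `x ≱ y`, some member lists `x` before `y`. -/
def IsLocalRealiser {α : Type*} [PartialOrder α] {ι : Type*} (F : ι → PLE α) : Prop :=
  ∀ x y : α, ¬ y ≤ x → ∃ i, (F i).Before x y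

/-- The multiplicity of `x` in a finite family of partial linear extensions:
the number of members whose ground set contains `x`. -/
noncomputable def mult {α : Type*} [PartialOrder α] {N : ℕ} (F : Fin N → PLE α) (x : α) : ℕ :=
  (Finset.univ.filter fun i => x ∈ (F i).toList).card

/-- The local dimension of a finite poset: the least `d` such that there is a
local realiser in which every element has multiplicity at most `d`. -/
noncomputable def ldim (α : Type*) [PartialOrder α] [Fintype α] : ℕ :=
  sInf {d | ∃ (N : ℕ) (F : Fin N → PLE α), IsLocalRealiser F ∧ ∀ x : α, mult F x ≤ d}

/-- The order dimension of a finite poset: the least `d` such that some family of `d`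
linear extensions (partial linear extensions containing every element) is a realiser. -/
noncomputable def odim (α : Type*) [PartialOrder α] [Fintype α] : ℕ :=
  sInf {d | ∃ F : Fin d → PLE α, (∀ i, ∀ x : α, x ∈ (F i).toList) ∧ IsLocalRealiser F}

/-- `BoolLayers n ℓ k` is the suborder of the Boolean lattice `Q(n)` induced by the
`ℓ`-th and `k`-th layers: all subsets of an `n`-set of cardinality `ℓ` or `k`,
ordered by inclusion. -/
abbrev BoolLayers (n ℓ k : ℕ) := {s : Finset (Fin n) // s.card = ℓ ∨ s.card = k}

end PaperLD

open PaperLD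

namespace PaperLD

/-- The poset of the integers `1, …, n` ordered by divisibility. -/
def DivPoset (n : ℕ) : Type := {m : ℕ // m ∈ Finset.Icc 1 n}

noncomputable instance (n : ℕ) : Fintype (DivPoset n) := FinsetCoe.fintype _

instance (n : ℕ) : PartialOrder (DivPoset n) where
  le a b := a.val ∣ b.val
  le_refl a := dvd_rfl
  le_trans a b c hab hbc := dvd_trans hab hbc
  le_antisymm a b hab hba := Subtype.ext (Nat.dvd_antisymm hab hba)

end PaperLD

namespace PaperLD

section Realiser

variable {α : Type*} [PartialOrder α]

lemma PLE.before_iff (L : PLE α) (x y : α) :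
    L.Before x y ↔ x ∈ L.toList ∧ y ∈ L.toList ∧ L.toList.idxOf x ≤ L.toList.idxOf y := by
  constructor
  · rintro ⟨i, j, hij, rfl, rfl⟩
    refine ⟨List.get_mem _ _, List.get_mem _ _, ?_⟩
    simpa [L.nodup.idxOf_getElem] using hij
  · rintro ⟨hx, hy, hxy⟩
    exact ⟨⟨_, List.idxOf_lt_length_iff.2 hx⟩, ⟨_, List.idxOf_lt_length_iff.2 hy⟩, hxy,
      by simp, by simp⟩

lemma PLE.idxOf_le_idxOf (L : PLE α) {x y : α} (hx : x ∈ L.toList) (hy : y ∈ L.toList)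
    (hxy : x ≤ y) : L.toList.idxOf x ≤ L.toList.idxOf y :=
  L.le_imp ⟨_, List.idxOf_lt_length_iff.2 hx⟩ ⟨_, List.idxOf_lt_length_iff.2 hy⟩ (by simpa)

/-- The partial linear extension listing just `x` and then `y`. -/
def PLE.pair (x y : α) (h : ¬ y ≤ x) : PLE α where
  toList := [x, y]
  nodup := by
    have : x ≠ y := fun e => h e.ge
    simpa
  le_imp i j hij := by
    fin_cases i <;> fin_cases j <;> simp_all

lemma exists_isLocalRealiser (α : Type*) [PartialOrder α] [Fintype α] :
    ∃ (N : ℕ) (F : Fin N → PLE α), IsLocalRealiser F := by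
  let e := Fintype.equivFin {p : α × α // ¬ p.2 ≤ p.1}
  refine ⟨_, fun i => PLE.pair (e.symm i).1.1 (e.symm i).1.2 (e.symm i).2, fun x y h => ?_⟩
  refine ⟨e ⟨(x, y), h⟩, ⟨0, by simp [PLE.pair]⟩, ⟨1, by simp [PLE.pair]⟩, ?_, ?_, ?_⟩ <;>
    simp [PLE.pair]

lemma exists_isLocalRealiser_mult_le_ldim (α : Type*) [PartialOrder α] [Fintype α] :
    ∃ (N : ℕ) (F : Fin N → PLE α), IsLocalRealiser F ∧ ∀ x, mult F x ≤ ldim α := by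
  obtain ⟨N, F, hF⟩ := exists_isLocalRealiser α
  refine Nat.sInf_mem (s := {d | ∃ (N : ℕ) (F : Fin N → PLE α),
    IsLocalRealiser F ∧ ∀ x : α, mult F x ≤ d}) ⟨N, N, F, hF, fun x => ?_⟩
  exact (Finset.card_filter_le _ _).trans (by simp)

/-- A ground set of size at most `m * t` has at most `(3 * m) ^ t` subsets of size at most `t`. -/
lemma card_le_three_mul_pow {β : Type*} {U : Finset β} {𝒮 : Finset (Finset β)} {m t : ℕ}
    (hm : 0 < m) (hU : U.card ≤ m * t) (h𝒮 : ∀ S ∈ 𝒮, S ⊆ U ∧ S.card ≤ t) :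
    𝒮.card ≤ (3 * m) ^ t := by
  have hm' : (1 : ℝ) ≤ m := by exact_mod_cast hm
  have hm0 : (0 : ℝ) < m := by linarith
  have hinv : (m : ℝ)⁻¹ ≤ 1 := inv_le_one_of_one_le₀ hm'
  have hsum : (𝒮.card : ℝ) * (m : ℝ)⁻¹ ^ t ≤ 3 ^ t := calc
    (𝒮.card : ℝ) * (m : ℝ)⁻¹ ^ t = ∑ _S ∈ 𝒮, (m : ℝ)⁻¹ ^ t := by simp
    _ ≤ ∑ S ∈ 𝒮, (m : ℝ)⁻¹ ^ S.card := Finset.sum_le_sum fun S hS =>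
        pow_le_pow_of_le_one (by positivity) hinv (h𝒮 S hS).2
    _ ≤ ∑ S ∈ U.powerset, (m : ℝ)⁻¹ ^ S.card :=
        Finset.sum_le_sum_of_subset_of_nonneg
          (fun S hS => Finset.mem_powerset.2 (h𝒮 S hS).1) fun _ _ _ => by positivity
    _ = ((m : ℝ)⁻¹ + 1) ^ U.card := by
        simpa using Finset.sum_pow_mul_eq_add_pow (m : ℝ)⁻¹ 1 U
    _ ≤ ((m : ℝ)⁻¹ + 1) ^ (m * t) := by
        gcongr
        linarith [inv_pos.2 hm0]
    _ ≤ (Real.exp (m : ℝ)⁻¹) ^ (m * t) := by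
        gcongr
        exact Real.add_one_le_exp _
    _ = Real.exp 1 ^ t := by
        rw [pow_mul, ← Real.exp_nat_mul, mul_inv_cancel₀ hm0.ne']
    _ ≤ 3 ^ t := by
        gcongr
        exact Real.exp_one_lt_three.le
  have : (𝒮.card : ℝ) ≤ (3 * m) ^ t := by
    rw [inv_pow, ← div_eq_mul_inv, div_le_iff₀ (by positivity)] at hsum
    rwa [mul_pow]
  exact_mod_cast this

/-- If the elements of a family are distinguished by which members of `A` lie below them,
the size of the family is bounded in terms of `A.card` and the local dimension. -/
lemma card_le_three_mul_pow_ldim [Fintype α] {κ : Type*} [Fintype κ] (A : Finset α) (b : κ → α)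
    (hb : ∀ s s', (∀ x ∈ A, x ≤ b s ↔ x ≤ b s') → s = s') {m : ℕ} (hm : 0 < m)
    (hA : A.card ≤ m) : Fintype.card κ ≤ (3 * m) ^ ldim α := by
  obtain ⟨N, F, hF, hmult⟩ := exists_isLocalRealiser_mult_le_ldim α
  let U : Finset (Σ _ : α, Fin N) := A.sigma fun x => Finset.univ.filter fun i => x ∈ (F i).toList
  have hU : U.card ≤ m * ldim α := calc
    U.card = ∑ x ∈ A, mult F x := Finset.card_sigma _ _
    _ ≤ A.card * ldim α := by simpa using Finset.sum_le_card_nsmul A _ _ fun x _ => hmult x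
    _ ≤ m * ldim α := by gcongr
  let after (s : κ) (i : Fin N) : Finset α := A.filter fun x =>
    x ∈ (F i).toList ∧ (F i).toList.idxOf (b s) < (F i).toList.idxOf x
  have hfirst : ∀ s i, ∃ c, (after s i).Nonempty → c ∈ after s i ∧
      ∀ x ∈ after s i, (F i).toList.idxOf c ≤ (F i).toList.idxOf x := by
    intro s i
    by_cases h : (after s i).Nonempty
    · obtain ⟨c, hc⟩ := Finset.exists_min_image _ (fun x => (F i).toList.idxOf x) h
      exact ⟨c, fun _ => hc⟩
    · exact ⟨b s, fun h' => absurd h' h⟩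
  choose first hfirst using hfirst
  let g (s : κ) : Finset (Σ _ : α, Fin N) := (Finset.univ.filter fun i =>
    b s ∈ (F i).toList ∧ (after s i).Nonempty).image fun i => ⟨first s i, i⟩
  have hg : ∀ s, g s ⊆ U ∧ (g s).card ≤ ldim α := by
    intro s
    constructor
    · intro c hc
      simp only [g, Finset.mem_image, Finset.mem_filter, Finset.mem_univ, true_and] at hc
      obtain ⟨i, ⟨-, hi⟩, rfl⟩ := hc
      have := (hfirst s i hi).1
      simp only [after, Finset.mem_filter] at this
      simp [U, this]
    · refine Finset.card_image_le.trans ((Finset.card_le_card ?_).trans (hmult (b s)))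
      intro i
      simp +contextual
  have htrace : ∀ s, ∀ x ∈ A, ¬ x ≤ b s ↔ ∃ c ∈ g s,
      x ∈ (F c.2).toList ∧ (F c.2).toList.idxOf c.1 ≤ (F c.2).toList.idxOf x := by
    intro s x hx
    constructor
    · intro h
      obtain ⟨i, hi⟩ := hF (b s) x h
      obtain ⟨h1, h2, h3⟩ := ((F i).before_iff _ _).1 hi
      have hne : (F i).toList.idxOf (b s) ≠ (F i).toList.idxOf x := fun e =>
        h ((List.idxOf_inj h1).1 e).ge
      have hmem : x ∈ after s i := by
        simp only [after, Finset.mem_filter]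
        exact ⟨hx, h2, lt_of_le_of_ne h3 hne⟩
      refine ⟨⟨first s i, i⟩, ?_, h2, (hfirst s i ⟨x, hmem⟩).2 x hmem⟩
      simp only [g, Finset.mem_image, Finset.mem_filter, Finset.mem_univ, true_and]
      exact ⟨i, ⟨h1, x, hmem⟩, rfl⟩
    · rintro ⟨c, hc, hxc, hle⟩ hxb
      simp only [g, Finset.mem_image, Finset.mem_filter, Finset.mem_univ, true_and] at hc
      obtain ⟨i, ⟨hbi, hi⟩, rfl⟩ := hc
      have := (hfirst s i hi).1
      simp only [after, Finset.mem_filter] at this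
      have := (F i).idxOf_le_idxOf hxc hbi hxb
      dsimp only at hle
      omega
  have hinj : Function.Injective g := fun s s' h => hb s s' fun x hx => by
    rw [← not_iff_not, htrace s x hx, htrace s' x hx, h]
  have := card_le_three_mul_pow (𝒮 := Finset.univ.image g) hm hU (by simpa using hg)
  rwa [Finset.card_image_of_injective _ hinj, Finset.card_univ] at this

end Realiser

lemma choose_primeCounting_le {n x k : ℕ} (hx : 2 ≤ x) (hk : 0 < k) (hn : x ^ k ≤ n) :
    (Nat.primeCounting x).choose k ≤ (3 * Nat.primeCounting x) ^ ldim (DivPoset n) := by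
  have hxn : x ≤ n := (Nat.le_self_pow hk.ne' x).trans hn
  let κ := {S : Finset ℕ // S ∈ Finset.powersetCard k (Nat.primesLE x)}
  have hκ : ∀ S : κ, (∀ p ∈ S.1, p ≤ x ∧ p.Prime) ∧ S.1.card = k := by
    intro S
    have := Finset.mem_powersetCard.1 S.2
    exact ⟨fun p hp => Nat.mem_primesLE.1 (this.1 hp), this.2⟩
  let b (S : κ) : DivPoset n := ⟨∏ p ∈ S.1, p, Finset.mem_Icc.2
    ⟨Finset.prod_pos fun p hp => ((hκ S).1 p hp).2.pos, by
      refine le_trans ?_ hn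
      have := Finset.prod_le_pow_card S.1 (fun p => p) x fun p hp => ((hκ S).1 p hp).1
      rwa [(hκ S).2] at this⟩⟩
  let A : Finset (DivPoset n) := Finset.univ.filter fun a => a.val ∈ Nat.primesLE x
  have hA : A.card ≤ Nat.primeCounting x := by
    rw [← Nat.primesLE_card_eq_primeCounting]
    refine Finset.card_le_card_of_injOn (fun a => a.val) (fun a ha => ?_)
      fun a _ a' _ h => Subtype.ext h
    simpa [A] using ha
  have hdvd : ∀ (S : κ) (p : ℕ), p.Prime → (p ∣ ∏ q ∈ S.1, q ↔ p ∈ S.1) := by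
    intro S p hp
    rw [hp.prime.dvd_finsetProd_iff]
    refine ⟨fun ⟨q, hq, hpq⟩ => ?_, fun h => ⟨p, h, dvd_rfl⟩⟩
    rwa [(Nat.prime_dvd_prime_iff_eq hp ((hκ S).1 q hq).2).1 hpq]
  have hm : 0 < Nat.primeCounting x := by
    rw [← Nat.primesLE_card_eq_primeCounting]
    exact Finset.card_pos.2 ⟨2, Nat.mem_primesLE.2 ⟨hx, Nat.prime_two⟩⟩
  have := card_le_three_mul_pow_ldim A b (fun S S' h => ?_) hm hA
  · rwa [Fintype.card_coe, Finset.card_powersetCard, Nat.primesLE_card_eq_primeCounting] at this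
  · have key : ∀ p ≤ x, p.Prime → (p ∈ S.1 ↔ p ∈ S'.1) := by
      intro p hpx hp
      rw [← hdvd S p hp, ← hdvd S' p hp]
      exact h ⟨p, Finset.mem_Icc.2 ⟨hp.one_le, hpx.trans hxn⟩⟩
        (Finset.mem_filter.2 ⟨Finset.mem_univ _, Nat.mem_primesLE.2 ⟨hpx, hp⟩⟩)
    refine Subtype.ext (Finset.ext fun p => ⟨fun hp => ?_, fun hp => ?_⟩)
    · obtain ⟨h1, h2⟩ := (hκ S).1 p hp
      exact (key p h1 h2).1 hp
    · obtain ⟨h1, h2⟩ := (hκ S').1 p hp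
      exact (key p h1 h2).2 hp

lemma div_two_mul_pow_le_choose {m k : ℕ} (hkm : 2 * k ≤ m) :
    ((m : ℝ) / (2 * k)) ^ k ≤ m.choose k := by
  rcases Nat.eq_zero_or_pos k with rfl | hk
  · simp
  have hk' : (0 : ℝ) < k := by exact_mod_cast hk
  have h1 : (m + 1 - k) ^ k ≤ k ^ k * m.choose k :=
    (Nat.pow_sub_le_descFactorial m k).trans <| by
      rw [Nat.descFactorial_eq_factorial_mul_choose]
      exact Nat.mul_le_mul_right _ (Nat.factorial_le_pow k)
  have h2 : (m : ℝ) / 2 ≤ (m + 1 - k : ℕ) := by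
    have : (m : ℝ) ≤ 2 * (m + 1 - k : ℕ) := by
      exact_mod_cast (by omega : m ≤ 2 * (m + 1 - k))
    linarith
  have h3 : ((m : ℝ) / 2) ^ k ≤ k ^ k * m.choose k :=
    (pow_le_pow_left₀ (by positivity) h2 k).trans (by exact_mod_cast h1)
  rw [← div_div, div_pow _ (k : ℝ), div_le_iff₀ (by positivity)]
  linarith

lemma half_div_log_le_primeCounting {y : ℝ} (hy : 200 ≤ y) :
    y / 2 / Real.log y ≤ Nat.primeCounting ⌊y⌋₊ := by
  refine le_trans ?_ (Chebyshev.pi_ge' (by linarith))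
  have hlog : 0 < Real.log y := Real.log_pos (by linarith)
  gcongr
  have h1 : Real.log (y + 2) ≤ (y + 2) / 20 + 18 := by
    have e : y + 2 = (y + 2) / 20 * 20 := by ring
    rw [e, Real.log_mul (by positivity) (by norm_num), ← e]
    have := Real.log_le_sub_one_of_pos (show 0 < (y + 2) / 20 by linarith)
    have := Real.log_le_sub_one_of_pos (show (0 : ℝ) < 20 by norm_num)
    linarith
  nlinarith [Real.log_two_gt_d9]

lemma mul_log_sub_le_ldim_mul {n : ℕ} {ℓ : ℝ} (hℓ : Real.logb 2 n = ℓ) (h15 : 15 ≤ ℓ) :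
    (ℓ / (2 * Real.logb 2 ℓ) - 1) * (Real.log ℓ - Real.log 4) ≤
      ldim (DivPoset n) * (2 * Real.log ℓ + Real.log 3) := by
  set μ := Real.logb 2 ℓ with hμ
  set k := ⌊ℓ / (2 * μ)⌋₊ with hk
  set m := Nat.primeCounting ⌊ℓ ^ 2⌋₊ with hm
  have hℓ0 : 0 < ℓ := by linarith
  have hlog : 0 < Real.log ℓ := Real.log_pos (by linarith)
  have hlog4 : Real.log 4 ≤ Real.log ℓ := Real.log_le_log (by norm_num) (by linarith)
  have hlog3 : 0 < Real.log 3 := Real.log_pos (by norm_num)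
  have hμ0 : 0 < μ := Real.logb_pos (by norm_num) (by linarith)
  have hn0 : (0 : ℝ) < n := by
    rcases Nat.eq_zero_or_pos n with rfl | h
    · simp at hℓ; linarith
    · exact_mod_cast h
  have hk1 : ℓ / (2 * μ) - 1 ≤ k := by linarith [Nat.lt_floor_add_one (ℓ / (2 * μ))]
  refine le_trans (mul_le_mul_of_nonneg_right hk1 (by linarith)) ?_
  rcases Nat.eq_zero_or_pos k with hk0 | hk0
  · rw [hk0]
    simp only [Nat.cast_zero, zero_mul]
    positivity
  have hk0' : (0 : ℝ) < k := by exact_mod_cast hk0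
  have hkle : k * (2 * μ) ≤ ℓ := by
    rw [← le_div_iff₀ (by positivity)]
    exact Nat.floor_le (by positivity)
  have hkle' : 2 * k * Real.log ℓ ≤ ℓ := by
    have : Real.log ℓ ≤ μ := by
      rw [hμ, Real.logb, le_div_iff₀ (Real.log_pos (by norm_num))]
      nlinarith [Real.log_two_lt_d9]
    nlinarith
  have hmge : ℓ ^ 2 ≤ 4 * m * Real.log ℓ := by
    have := half_div_log_le_primeCounting (y := ℓ ^ 2) (by nlinarith)
    rw [Real.log_pow, div_le_iff₀ (by positivity)] at this
    push_cast at this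
    linarith
  have hmk : ℓ * (2 * k) ≤ 4 * m := by
    refine le_of_mul_le_mul_right ?_ hlog
    nlinarith
  have hmle : (m : ℝ) ≤ ℓ ^ 2 := by
    have h1 : m ≤ ⌊ℓ ^ 2⌋₊ := by
      rw [hm, ← Nat.primesLE_card_eq_primeCounting]
      refine (Finset.card_le_card (t := Finset.Icc 1 ⌊ℓ ^ 2⌋₊) fun p hp => ?_).trans (by simp)
      obtain ⟨h1, h2⟩ := Nat.mem_primesLE.1 hp
      exact Finset.mem_Icc.2 ⟨h2.one_le, h1⟩
    exact (Nat.cast_le.2 h1).trans (Nat.floor_le (by positivity))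
  have h2km : 2 * k ≤ m := by
    have : (2 * k : ℝ) ≤ m := by nlinarith
    exact_mod_cast this
  have hpow : ⌊ℓ ^ 2⌋₊ ^ k ≤ n := by
    have : ((⌊ℓ ^ 2⌋₊ : ℝ)) ^ k ≤ n := calc
      ((⌊ℓ ^ 2⌋₊ : ℝ)) ^ k ≤ (ℓ ^ 2) ^ k := by
        gcongr
        exact Nat.floor_le (by positivity)
      _ ≤ n := by
        rw [← Real.log_le_log_iff (by positivity) hn0, ← pow_mul, Real.log_pow]
        have e1 : Real.log ℓ = μ * Real.log 2 := by
          rw [hμ, Real.logb, div_mul_cancel₀ _ (Real.log_pos (by norm_num)).ne']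
        have e2 : Real.log n = ℓ * Real.log 2 := by
          rw [← hℓ, Real.logb, div_mul_cancel₀ _ (Real.log_pos (by norm_num)).ne']
        rw [e1, e2, ← mul_assoc]
        refine mul_le_mul_of_nonneg_right ?_ (Real.log_pos (by norm_num)).le
        push_cast
        linarith
    exact_mod_cast this
  have hmain := choose_primeCounting_le (Nat.le_floor (by push_cast; nlinarith)) hk0 hpow
  have hfin : (ℓ / 4) ^ k ≤ (3 * ℓ ^ 2) ^ ldim (DivPoset n) := calc
    (ℓ / 4) ^ k ≤ ((m : ℝ) / (2 * k)) ^ k := by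
      refine pow_le_pow_left₀ (by positivity) ?_ k
      rw [div_le_div_iff₀ (by norm_num) (by positivity)]
      linarith
    _ ≤ m.choose k := div_two_mul_pow_le_choose h2km
    _ ≤ (3 * m) ^ ldim (DivPoset n) := by exact_mod_cast hmain
    _ ≤ (3 * ℓ ^ 2) ^ ldim (DivPoset n) := by gcongr
  have := Real.log_le_log (by positivity) hfin
  rw [Real.log_pow, Real.log_pow, Real.log_div hℓ0.ne' (by norm_num),
    Real.log_mul (by norm_num) (by positivity), Real.log_pow] at this
  push_cast at this
  linarith

open Filter Topology in
lemma tendsto_half_sub_mul_div_log :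
    Tendsto (fun ℓ : ℝ => (1 / 2 - Real.logb 2 ℓ / ℓ) *
      ((Real.log ℓ - Real.log 4) / (2 * Real.log ℓ + Real.log 3))) atTop (𝓝 (1 / 4)) := by
  have h1 : Tendsto (fun ℓ : ℝ => Real.logb 2 ℓ / ℓ) atTop (𝓝 0) := by
    have := (Real.isLittleO_log_id_atTop.tendsto_div_nhds_zero).div_const (Real.log 2)
    rw [zero_div] at this
    exact this.congr fun ℓ => by simp only [Real.logb, id]; ring
  have h2 (a : ℝ) : Tendsto (fun ℓ : ℝ => a / Real.log ℓ) atTop (𝓝 0) :=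
    tendsto_const_nhds.div_atTop Real.tendsto_log_atTop
  have h3 : Tendsto (fun ℓ : ℝ => (Real.log ℓ - Real.log 4) / (2 * Real.log ℓ + Real.log 3))
      atTop (𝓝 ((1 - 0) / (2 + 0))) := by
    refine (((h2 (Real.log 4)).const_sub 1).div ((h2 (Real.log 3)).const_add 2)
      (by norm_num)).congr' ?_
    filter_upwards [eventually_gt_atTop 1] with ℓ hℓ
    have : 0 < Real.log ℓ := Real.log_pos hℓ
    have : 0 < Real.log 3 := Real.log_pos (by norm_num)
    simp only [Pi.div_apply]
    field_simp
  convert (h1.const_sub (1 / 2)).mul h3 using 2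
  norm_num

end PaperLD

/-- For every `ε > 0` there is `n₀` such that for all `n ≥ n₀`, the divisibility order on
`{1, …, n}` satisfies `ldim ≥ (1/4 − ε)·log n/log log n` (logs base 2). -/
theorem stmt13 (ε : ℝ) (hε : 0 < ε) :
    ∃ n₀ : ℕ, ∀ n : ℕ, n₀ ≤ n →
      (1 / 4 - ε) * (Real.logb 2 n / Real.logb 2 (Real.logb 2 n)) ≤
        (ldim (DivPoset n) : ℝ) := by
  have hlim : Filter.Tendsto (fun n : ℕ => Real.logb 2 n) Filter.atTop Filter.atTop :=
    (Real.tendsto_logb_atTop (by norm_num)).comp tendsto_natCast_atTop_atTop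
  have hev := hlim.eventually ((tendsto_half_sub_mul_div_log.eventually_const_lt
    (show 1 / 4 - ε < 1 / 4 by linarith)).and (Filter.eventually_ge_atTop 15))
  obtain ⟨n₀, hn₀⟩ := Filter.eventually_atTop.1 hev
  refine ⟨n₀, fun n hn => ?_⟩
  obtain ⟨h1, h15⟩ := hn₀ n hn
  have h2 := mul_log_sub_le_ldim_mul rfl h15
  set ℓ := Real.logb 2 n
  have hμ : 0 < Real.logb 2 ℓ := Real.logb_pos (by norm_num) (by linarith)
  have hlog : 0 < Real.log ℓ := Real.log_pos (by linarith)
  have hlog3 : 0 < Real.log 3 := Real.log_pos (by norm_num)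
  calc (1 / 4 - ε) * (ℓ / Real.logb 2 ℓ)
      ≤ ((1 / 2 - Real.logb 2 ℓ / ℓ) *
          ((Real.log ℓ - Real.log 4) / (2 * Real.log ℓ + Real.log 3))) *
          (ℓ / Real.logb 2 ℓ) := by gcongr
    _ = (ℓ / (2 * Real.logb 2 ℓ) - 1) * (Real.log ℓ - Real.log 4) /
          (2 * Real.log ℓ + Real.log 3) := by
        field_simp
    _ ≤ ldim (DivPoset n) := by
        rwa [div_le_iff₀ (by positivity)]
end

section
/- Let G be a bipartite graph with parts A and B and exactly n ≥ 1 edges, in which every vertex of A has degree at most Δ (with Δ ≥ 1), and let ℓ, k be integers with 1 ≤ ℓ < k ≤ n. Then ldim(Q(n; ℓ, k)) ≤ max{ 2^(Δ−1) · ℓ + 2, |A| + 2 }. -/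
open scoped Classical

open PaperLD

namespace PaperLD

/-- A list in which no element is preceded by one above it or equal to it is a partial linear
extension. -/
def PLE.ofPairwise {α : Type*} [PartialOrder α] (l : List α)
    (h : l.Pairwise fun x y => ¬ y ≤ x) : PLE α where
  toList := l
  nodup := h.imp fun hxy hEq => hxy hEq.ge
  le_imp i j hij := by
    by_contra! hlt
    exact List.pairwise_iff_get.mp h j i hlt hij

theorem PLE.before_of_sublist {α : Type*} [PartialOrder α] {L : PLE α} {x y : α}
    (h : [x, y].Sublist L.toList) : L.Before x y := by
  obtain ⟨g, hg⟩ := List.sublist_iff_exists_fin_orderEmbedding_get_eq.mp h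
  exact ⟨g ⟨0, by simp⟩, g ⟨1, by simp⟩, g.monotone (by simp),
    (hg ⟨0, by simp⟩).symm, (hg ⟨1, by simp⟩).symm⟩

theorem pair_sublist_or {α : Type*} {x y : α} (hxy : x ≠ y) {l : List α} (hx : x ∈ l)
    (hy : y ∈ l) : [x, y].Sublist l ∨ [y, x].Sublist l := by
  induction l with
  | nil => simp at hx
  | cons a l ih =>
    rcases List.mem_cons.mp hx with rfl | hxl
    · exact .inl ((List.singleton_sublist.mpr
        ((List.mem_cons.mp hy).resolve_left hxy.symm)).cons_cons x)
    · rcases List.mem_cons.mp hy with rfl | hyl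
      · exact .inr ((List.singleton_sublist.mpr hxl).cons_cons y)
      · exact (ih hxl hyl).imp (·.cons a) (·.cons a)

theorem pair_sublist_append {α : Type*} {x y : α} {l₁ l₂ : List α} (hx : x ∈ l₁)
    (hy : y ∈ l₂) : [x, y].Sublist (l₁ ++ l₂) :=
  (List.singleton_sublist.mpr hx).append (List.singleton_sublist.mpr hy)

theorem ldim_le {α ι : Type*} [PartialOrder α] [Fintype α] [Fintype ι] (F : ι → PLE α)
    (hF : IsLocalRealiser F) (d : ℕ)
    (hd : ∀ x, (Finset.univ.filter fun i => x ∈ (F i).toList).card ≤ d) : ldim α ≤ d := by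
  let e := Fintype.equivFin ι
  refine Nat.sInf_le ⟨Fintype.card ι, F ∘ e.symm, fun x y hxy => ?_, fun x => ?_⟩
  · obtain ⟨i, hi⟩ := hF x y hxy
    exact ⟨e i, by simpa using hi⟩
  · refine le_trans (Finset.card_le_card_of_injOn e.symm ?_ e.symm.injective.injOn) (hd x)
    intro i hi
    simpa using hi

section Layers

variable {n ℓ k : ℕ}

theorem pairwise_not_le_append {l₁ l₂ : List (BoolLayers n ℓ k)} (h₁ : l₁.Nodup)
    (h₂ : l₂.Nodup) {c₁ c₂ : ℕ} (hc₁ : ∀ s ∈ l₁, s.1.card = c₁) (hc₂ : ∀ s ∈ l₂, s.1.card = c₂)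
    (h : ∀ s ∈ l₁, ∀ t ∈ l₂, ¬ t ≤ s) : (l₁ ++ l₂).Pairwise fun x y => ¬ y ≤ x := by
  have key : ∀ {l : List (BoolLayers n ℓ k)} {c : ℕ}, l.Nodup → (∀ s ∈ l, s.1.card = c) →
      l.Pairwise fun x y => ¬ y ≤ x := fun hl hc =>
    List.Pairwise.imp_of_mem (fun {a b} ha hb hab hle => hab
      (Subtype.ext (Finset.eq_of_subset_of_card_le hle ((hc a ha).trans (hc b hb).symm).le)).symm) hl
  exact List.pairwise_append.mpr ⟨key h₁ hc₁, key h₂ hc₂, h⟩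

/-- The elements of the `c`-th layer. -/
noncomputable def layer (n ℓ k c : ℕ) : List (BoolLayers n ℓ k) :=
  (Finset.univ.filter fun s : BoolLayers n ℓ k => s.1.card = c).toList

theorem mem_layer {c : ℕ} {s : BoolLayers n ℓ k} : s ∈ layer n ℓ k c ↔ s.1.card = c := by
  simp [layer]

theorem nodup_layer (c : ℕ) : (layer n ℓ k c).Nodup := Finset.nodup_toList _

theorem not_le_of_card_lt {s t : BoolLayers n ℓ k} (h : s.1.card < t.1.card) : ¬ t ≤ s :=
  fun hle => h.not_ge (Finset.card_le_card hle)

/-- The lower layer followed by the upper one, each listed in a fixed order, or in the reverse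
of that order when the Boolean is true. -/
noncomputable def fullExtension (hℓk : ℓ < k) (b : Bool) : PLE (BoolLayers n ℓ k) :=
  let r : List (BoolLayers n ℓ k) → List (BoolLayers n ℓ k) := if b then List.reverse else id
  have hr : ∀ c, (r (layer n ℓ k c)).Nodup ∧ ∀ s ∈ r (layer n ℓ k c), s.1.card = c := by
    intro c
    cases b <;> simp +contextual [r, nodup_layer, mem_layer]
  PLE.ofPairwise (r (layer n ℓ k ℓ) ++ r (layer n ℓ k k)) <|
    pairwise_not_le_append (hr ℓ).1 (hr k).1 (hr ℓ).2 (hr k).2 fun s hs t ht =>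
      not_le_of_card_lt (((hr ℓ).2 s hs).trans_lt (hℓk.trans_eq ((hr k).2 t ht).symm))

theorem exists_fullExtension_before (hℓk : ℓ < k) {x y : BoolLayers n ℓ k} (hxy : x ≠ y)
    (h : x.1.card = ℓ ∨ y.1.card = k) : ∃ b, (fullExtension hℓk b).Before x y := by
  have same : ∀ c, x.1.card = c → y.1.card = c → (c = ℓ ∨ c = k) →
      ∃ b, (fullExtension hℓk b).Before x y := by
    intro c hx hy hc
    rcases pair_sublist_or hxy (mem_layer.mpr hx) (mem_layer.mpr hy) with hs | hs
    · refine ⟨false, PLE.before_of_sublist (hs.trans ?_)⟩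
      rcases hc with rfl | rfl
      exacts [List.sublist_append_left _ _, List.sublist_append_right _ _]
    · have hs' : [x, y].Sublist (layer n ℓ k c).reverse := by simpa using hs.reverse
      refine ⟨true, PLE.before_of_sublist (hs'.trans ?_)⟩
      rcases hc with rfl | rfl
      exacts [List.sublist_append_left _ _, List.sublist_append_right _ _]
  rcases x.2 with hx | hx <;> rcases y.2 with hy | hy
  · exact same ℓ hx hy (.inl rfl)
  · exact ⟨false, PLE.before_of_sublist
      (pair_sublist_append (mem_layer.mpr hx) (mem_layer.mpr hy))⟩
  · omega
  · exact same k hx hy (.inr rfl)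

variable {A : Type*}

/-- The elements mapped to `a`. -/
noncomputable def fiber (f : Fin n → A) (a : A) : Finset (Fin n) :=
  Finset.univ.filter fun e => f e = a

/-- The `k`-sets with trace `C` on the fiber over `a`, followed by the `ℓ`-sets whose trace on
that fiber is not contained in `C`, where `p = (a, C)`. -/
noncomputable def traceExtension (f : Fin n → A) (p : A × Finset (Fin n)) :
    PLE (BoolLayers n ℓ k) :=
  PLE.ofPairwise
    ((Finset.univ.filter fun t : BoolLayers n ℓ k =>
        t.1.card = k ∧ t.1 ∩ fiber f p.1 = p.2).toList ++
      (Finset.univ.filter fun s : BoolLayers n ℓ k =>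
        s.1.card = ℓ ∧ p.2 ⊆ fiber f p.1 ∧ ¬ s.1 ∩ fiber f p.1 ⊆ p.2).toList) <| by
    refine pairwise_not_le_append (c₁ := k) (c₂ := ℓ) (Finset.nodup_toList _)
      (Finset.nodup_toList _) (fun s hs => ?_) (fun s hs => ?_) (fun s hs t ht hle => ?_)
    · exact (Finset.mem_filter.mp (Finset.mem_toList.mp hs)).2.1
    · exact (Finset.mem_filter.mp (Finset.mem_toList.mp hs)).2.1
    · have hs' := (Finset.mem_filter.mp (Finset.mem_toList.mp hs)).2
      have ht' := (Finset.mem_filter.mp (Finset.mem_toList.mp ht)).2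
      exact ht'.2.2 (hs'.2 ▸ Finset.inter_subset_inter_right hle)

theorem mem_traceExtension {f : Fin n → A} {p : A × Finset (Fin n)} {x : BoolLayers n ℓ k} :
    x ∈ (traceExtension f p : PLE (BoolLayers n ℓ k)).toList ↔
      (x.1.card = k ∧ x.1 ∩ fiber f p.1 = p.2) ∨
        (x.1.card = ℓ ∧ p.2 ⊆ fiber f p.1 ∧ ¬ x.1 ∩ fiber f p.1 ⊆ p.2) := by
  simp only [traceExtension, PLE.ofPairwise, List.mem_append, Finset.mem_toList,
    Finset.mem_filter, Finset.mem_univ, true_and]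

theorem exists_traceExtension_before (f : Fin n → A) {x y : BoolLayers n ℓ k}
    (hx : x.1.card = k) (hy : y.1.card = ℓ) (hxy : ¬ y ≤ x) :
    ∃ p, (traceExtension f p).Before x y := by
  obtain ⟨e, hey, hex⟩ := Finset.not_subset.mp hxy
  refine ⟨(f e, x.1 ∩ fiber f (f e)), PLE.before_of_sublist (pair_sublist_append ?_ ?_)⟩
  · simp [hx]
  · rw [Finset.mem_toList, Finset.mem_filter]
    refine ⟨Finset.mem_univ _, hy, Finset.inter_subset_right, fun h => hex ?_⟩
    exact (Finset.mem_inter.mp (h (Finset.mem_inter.mpr ⟨hey, by simp [fiber]⟩))).1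

theorem card_traceExtension_le [Fintype A] (f : Fin n → A) {Δ : ℕ}
    (hf : ∀ a, (fiber f a).card ≤ Δ) (hℓk : ℓ < k) (x : BoolLayers n ℓ k) :
    (Finset.univ.filter fun p =>
      x ∈ (traceExtension f p : PLE (BoolLayers n ℓ k)).toList).card ≤
        max (2 ^ (Δ - 1) * ℓ) (Fintype.card A) := by
  rcases x.2 with hx | hx
  · refine le_max_of_le_left (le_trans (Finset.card_le_card (t := x.1.biUnion fun e =>
      (((fiber f (f e)).erase e).powerset).image (Prod.mk (f e))) ?_) ?_)
    · rintro ⟨a, C⟩ hp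
      rcases mem_traceExtension.mp (Finset.mem_filter.mp hp).2 with h | ⟨-, hC, h⟩
      · omega
      · obtain ⟨e, he, heC⟩ := Finset.not_subset.mp h
        obtain ⟨hex, hea⟩ := Finset.mem_inter.mp he
        obtain rfl : f e = a := by simpa [fiber] using hea
        exact Finset.mem_biUnion.mpr ⟨e, hex, Finset.mem_image_of_mem _
          (Finset.mem_powerset.mpr (Finset.subset_erase.mpr ⟨hC, heC⟩))⟩
    · rw [mul_comm]
      refine le_of_le_of_eq ?_ (congrArg (· * 2 ^ (Δ - 1)) hx)
      refine Finset.card_biUnion_le_card_mul _ _ _ fun e _ => Finset.card_image_le.trans ?_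
      rw [Finset.card_powerset, Finset.card_erase_of_mem (by simp [fiber])]
      exact Nat.pow_le_pow_right two_pos (Nat.sub_le_sub_right (hf _) 1)
  · refine le_max_of_le_right (le_trans (Finset.card_le_card
      (t := Finset.univ.image fun a => (a, x.1 ∩ fiber f a)) ?_) Finset.card_image_le)
    rintro ⟨a, C⟩ hp
    rcases mem_traceExtension.mp (Finset.mem_filter.mp hp).2 with ⟨-, h⟩ | h
    · exact Finset.mem_image.mpr ⟨a, Finset.mem_univ _, Prod.ext rfl h⟩
    · omega

theorem ldim_boolLayers_le [Fintype A] (f : Fin n → A) {Δ : ℕ}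
    (hf : ∀ a, (fiber f a).card ≤ Δ) (hℓk : ℓ < k) :
    ldim (BoolLayers n ℓ k) ≤ max (2 ^ (Δ - 1) * ℓ + 2) (Fintype.card A + 2) := by
  refine ldim_le (Sum.elim (fullExtension hℓk) (traceExtension f)) (fun x y hxy => ?_) _
    fun x => ?_
  · by_cases h : x.1.card = ℓ ∨ y.1.card = k
    · obtain ⟨b, hb⟩ := exists_fullExtension_before hℓk (fun h => hxy h.ge) h
      exact ⟨.inl b, hb⟩
    · rw [not_or] at h
      obtain ⟨p, hp⟩ := exists_traceExtension_before f (x.2.resolve_left h.1)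
        (y.2.resolve_right h.2) hxy
      exact ⟨.inr p, hp⟩
  · refine le_trans (Finset.card_le_card (t := Finset.univ.disjSum (Finset.univ.filter fun p =>
      x ∈ (traceExtension f p : PLE (BoolLayers n ℓ k)).toList)) ?_) ?_
    · rintro (b | p) hp
      · simp
      · simpa using hp
    · have := card_traceExtension_le f hf hℓk x
      rw [Finset.card_disjSum, Finset.card_univ, Fintype.card_bool]
      omega

end Layers

end PaperLD

/-- Let `G` be a bipartite graph with parts `A`, `B` and exactly `n ≥ 1` edges, in which
every vertex of `A` has degree at most `Δ ≥ 1`, and let `1 ≤ ℓ < k ≤ n`. Then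
`ldim(Q(n; ℓ, k)) ≤ max{2^(Δ−1)·ℓ + 2, |A| + 2}`. -/
theorem stmt16 (A B : Type) [Fintype A] [Fintype B] (E : Finset (A × B))
    (n Δ ℓ k : ℕ) (hcard : E.card = n) (hn : 1 ≤ n) (hΔ : 1 ≤ Δ)
    (hdeg : ∀ a : A, (E.filter fun e => e.1 = a).card ≤ Δ)
    (hℓ : 1 ≤ ℓ) (hℓk : ℓ < k) (hk : k ≤ n) :
    ldim (BoolLayers n ℓ k) ≤ max (2 ^ (Δ - 1) * ℓ + 2) (Fintype.card A + 2) := by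
  let g : Fin n ≃ E := (finCongr hcard.symm).trans E.equivFin.symm
  refine ldim_boolLayers_le (fun i => (g i).1.1) (fun a => le_trans ?_ (hdeg a)) hℓk
  refine Finset.card_le_card_of_injOn (fun i => (g i).1) (fun i hi => ?_)
    (Subtype.val_injective.comp g.injective).injOn
  simpa [fiber] using hi
end
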